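/- There exists an integer n⋆(ε) such that for all integers n ≥ n⋆(ε) and all integers R ≥ 1, W_n^R ≤ (R + ε) n^{−(1+ε)/3}. -/

import Mathlib

noncomputable section

namespace CubePacking

/-- The side lengths `ℓ_k := k^{−(1+ε)/3}`. -/
def sideLen (ε : ℝ) (k : ℕ) : ℝ := (k : ℝ) ^ (-(1 + ε) / 3)

/-- `L_n^m := ∑_{k=n}^m ℓ_k`, the length needed to put the cubes `n,…,m` in a row. -/
def L (ε : ℝ) (n m : ℕ) : ℝ := ∑ k ∈ Finset.Icc n m, sideLen ε k

/-- `M_n := max{m ≥ n : L_n^m ≤ 1} − n + 1`, the number of cubes, starting from the `n`-th,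
fitting in a row of length `1`.  (The maximum exists for `n ≥ 1` since `ℓ_n ≤ 1` and
`L_n^m → ∞` as `m → ∞`; it is realized here by `sSup`, which coincides with the maximum
of a nonempty bounded-above set of naturals.) -/
def M (ε : ℝ) (n : ℕ) : ℕ := sSup {m : ℕ | n ≤ m ∧ L ε n m ≤ 1} - n + 1

/-- The index `B^n_r` of the first cube of the `r`-th row when rows are started at the `n`-th
cube: `B^n_1 := n` and `B^n_{r+1} := B^n_r + M_{B^n_r}` for `r ≥ 1`. -/
def B (ε : ℝ) (n : ℕ) : ℕ → ℕ
  | 0 => n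
  | 1 => n
  | r + 2 => B ε n (r + 1) + M ε (B ε n (r + 1))

/-- `W_n^R := ∑_{r=1}^R (B^n_r)^{−(1+ε)/3}`, the width occupied by `R` rows starting at the
`n`-th cube. -/
def W (ε : ℝ) (n R : ℕ) : ℝ := ∑ r ∈ Finset.Icc 1 R, (B ε n r : ℝ) ^ (-(1 + ε) / 3)

/-- `R_n := max{R ≥ 1 : W_n^R ≤ 1}`, the number of rows fitting in the unit square starting
from the `n`-th cube.  (Again the maximum is realized by `sSup`.) -/
def Rn (ε : ℝ) (n : ℕ) : ℕ := sSup {R : ℕ | 1 ≤ R ∧ W ε n R ≤ 1}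

/-- `N_n := B^n_{R_n+1} − n + 1`, the number of cubes in those rows. -/
def N (ε : ℝ) (n : ℕ) : ℕ := B ε n (Rn ε n + 1) - n + 1

/-- The index `S_l` of the cube starting the `l`-th vertical layer:
`S_1 := 1` and `S_{l+1} := S_l + N_{S_l}` for `l ≥ 1`. -/
def S (ε : ℝ) : ℕ → ℕ
  | 0 => 1
  | 1 => 1
  | l + 2 => S ε (l + 1) + N ε (S ε (l + 1))

/-- The height `H_l := S_l^{−(1+ε)/3}` of the `l`-th layer. -/
def H (ε : ℝ) (l : ℕ) : ℝ := (S ε l : ℝ) ^ (-(1 + ε) / 3)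

theorem le_B (ε : ℝ) (n r : ℕ) : n ≤ B ε n r := by
  induction r with
  | zero => exact le_rfl
  | succ r ih =>
    cases r with
    | zero => exact le_rfl
    | succ r => exact ih.trans (Nat.le_add_right _ _)

theorem W_le_mul {ε : ℝ} (hε : -1 ≤ ε) {n : ℕ} (hn : 1 ≤ n) (R : ℕ) :
    W ε n R ≤ (R : ℝ) * (n : ℝ) ^ (-(1 + ε) / 3) := by
  have hn' : (0 : ℝ) < n := by exact_mod_cast hn
  have h := Finset.sum_le_card_nsmul (Finset.Icc 1 R)
    (fun r => (B ε n r : ℝ) ^ (-(1 + ε) / 3)) ((n : ℝ) ^ (-(1 + ε) / 3)) fun r _ =>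
      Real.rpow_le_rpow_of_nonpos hn' (by exact_mod_cast le_B ε n r) (by linarith)
  simpa [W] using h

end CubePacking

open CubePacking in
/-- Upper bound on `W_n^R`.
There exists `n⋆(ε)` such that for all `n ≥ n⋆(ε)` and all `R ≥ 1`,
`W_n^R ≤ (R + ε) n^{−(1+ε)/3}`. -/
theorem W_upper_bound (ε : ℝ) (hε0 : 0 < ε) (hε : ε < 1 / 2) :
    ∃ nst : ℕ, ∀ n : ℕ, nst ≤ n → ∀ R : ℕ, 1 ≤ R →
      W ε n R ≤ ((R : ℝ) + ε) * (n : ℝ) ^ (-(1 + ε) / 3) := by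
  refine ⟨1, fun n hn R _ => (W_le_mul (by linarith) hn R).trans ?_⟩
  gcongr
  linarith
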